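/- arXiv:2604.23379 — 2 statements merged into one kernel-verified Lean document; each statement's English description precedes it below -/
import Mathlib

section
/- Let G be a finite simple graph, let x ∈ V(G) be the absorbing vertex, and let t : V(G) → ℝ satisfy the ASUA equations for (G, x). Let l ≥ 1 and let U = {u_1, …, u_l} be a stem of length l attached to a vertex v, with x ∉ U. Then t(u_j) = t(v) + l² − (j − 1)² for every j with 1 ≤ j ≤ l. -/
/-- `t : V → ℝ` satisfies the ASUA equations for the graph `G` with absorbing vertex `u`. -/
def SatisfiesASUA {V : Type*} [Fintype V] (G : SimpleGraph V) [DecidableRel G.Adj]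
    (u : V) (t : V → ℝ) : Prop :=
  t u = 0 ∧ ∀ v, v ≠ u →
    t v = 1 + (1 / (G.degree v : ℝ)) * ∑ w ∈ G.neighborFinset v, t w

/-- `u 1, …, u l` is a stem of length `l` attached to the vertex `v` in `G`:
the `u j` are distinct vertices different from `v`, `u j ~ u (j+1)` for `1 ≤ j ≤ l-1`,
`u l ~ v`, `deg (u 1) = 1`, and `deg (u j) = 2` for `2 ≤ j ≤ l`. -/
def IsStem {V : Type*} [Fintype V] (G : SimpleGraph V) [DecidableRel G.Adj]
    (v : V) (l : ℕ) (u : ℕ → V) : Prop :=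
  (∀ j, 1 ≤ j → j ≤ l → u j ≠ v) ∧
  Set.InjOn u (Set.Icc 1 l) ∧
  (∀ j, 1 ≤ j → j ≤ l - 1 → G.Adj (u j) (u (j + 1))) ∧
  G.Adj (u l) v ∧
  G.degree (u 1) = 1 ∧
  (∀ j, 2 ≤ j → j ≤ l → G.degree (u j) = 2)

namespace SatisfiesASUA

variable {V : Type*} [Fintype V] {G : SimpleGraph V} [DecidableRel G.Adj]
  {x : V} {t : V → ℝ}

/-- The ASUA equation at a non-absorbing leaf. -/
theorem eq_of_degree_eq_one (ht : SatisfiesASUA G x t) {a b : V} (ha : a ≠ x)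
    (hdeg : G.degree a = 1) (hab : G.Adj a b) : t a = 1 + t b := by
  have hN : G.neighborFinset a = {b} := by
    symm
    apply Finset.eq_of_subset_of_card_le
    · simpa using hab
    · simp [hdeg]
  have h := ht.2 a ha
  rw [hN, hdeg] at h
  simpa using h

/-- The ASUA equation at a non-absorbing vertex of degree two. -/
theorem eq_of_degree_eq_two (ht : SatisfiesASUA G x t) {a b c : V} (ha : a ≠ x)
    (hdeg : G.degree a = 2) (hab : G.Adj a b) (hac : G.Adj a c) (hbc : b ≠ c) :
    t a = 1 + (t b + t c) / 2 := by
  classical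
  have hN : G.neighborFinset a = {b, c} := by
    symm
    apply Finset.eq_of_subset_of_card_le
    · simp [Finset.insert_subset_iff, hab, hac]
    · simp [hdeg, Finset.card_pair hbc]
  have h := ht.2 a ha
  rw [hN, hdeg, Finset.sum_pair hbc] at h
  push_cast at h
  linarith

end SatisfiesASUA

/-- If `u 1, …, u l` is a stem attached to `v` not containing the absorbing vertex `x`,
then `t (u j) = t v + l² − (j−1)²` for `1 ≤ j ≤ l`. -/
theorem asua_stem {V : Type*} [Fintype V] [DecidableEq V]
    (G : SimpleGraph V) [DecidableRel G.Adj] (x : V)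
    (t : V → ℝ) (ht : SatisfiesASUA G x t)
    (v : V) (l : ℕ) (hl : 1 ≤ l) (u : ℕ → V)
    (hstem : IsStem G v l u)
    (hx : ∀ j, 1 ≤ j → j ≤ l → u j ≠ x) :
    ∀ j, 1 ≤ j → j ≤ l → t (u j) = t v + (l : ℝ) ^ 2 - ((j : ℝ) - 1) ^ 2 := by
  obtain ⟨hne, hinj, hadj, hlast, hdeg1, hdeg2⟩ := hstem
  -- Extend the stem by `v` at position `l + 1`, so that all steps look alike.
  let w : ℕ → V := fun j => if j ≤ l then u j else v
  have hw : ∀ j, j ≤ l → w j = u j := fun j hj => if_pos hj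
  have hwv : w (l + 1) = v := if_neg (by omega)
  have hwadj : ∀ j, 1 ≤ j → j ≤ l → G.Adj (u j) (w (j + 1)) := by
    intro j h1 h2
    rcases h2.eq_or_lt with rfl | h
    · rwa [hwv]
    · rw [hw _ h]
      exact hadj j h1 (by omega)
  have hstep : ∀ j, 1 ≤ j → j ≤ l → t (u j) = t (w (j + 1)) + (2 * (j : ℝ) - 1) := by
    intro j h1
    induction j, h1 using Nat.le_induction with
    | base =>
      intro h2
      have h := ht.eq_of_degree_eq_one (hx 1 le_rfl h2) hdeg1 (hwadj 1 le_rfl h2)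
      push_cast
      linarith
    | succ j h1 ih =>
      intro h2
      have ih' := ih (by omega)
      have hprev := hwadj j h1 (by omega)
      rw [hw _ h2] at ih' hprev
      have hdist : u j ≠ w (j + 1 + 1) := by
        rcases h2.eq_or_lt with h | h
        · rw [h, hwv]
          exact hne j h1 (by omega)
        · rw [hw _ h]
          intro heq
          have := hinj ⟨h1, by omega⟩ ⟨by omega, h⟩ heq
          omega
      have h := ht.eq_of_degree_eq_two (hx _ (by omega) h2) (hdeg2 _ (by omega) h2)
        hprev.symm (hwadj _ (by omega) h2) hdist
      push_cast
      linarith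
  intro j h1 h2
  have key : ∀ k, k ≤ l + 1 → 1 ≤ k →
      t (w k) = t v + (l : ℝ) ^ 2 - ((k : ℝ) - 1) ^ 2 := by
    intro k hk
    induction hk using Nat.decreasingInduction with
    | self =>
      intro _
      rw [hwv]
      push_cast
      ring
    | of_succ k hk ih =>
      intro h1
      have hkl : k ≤ l := by omega
      rw [hw k hkl, hstep k h1 hkl, ih (by omega)]
      push_cast
      ring
  rw [← hw j h2]
  exact key j (by omega) h1
end

section
/- Let G be a finite simple graph, let z ∈ V(G) be the absorbing vertex, and let t : V(G) → ℝ satisfy the ASUA equations for (G, z). Let v ≠ z be a vertex with N(v) = {x, y} ∪ {u_1, …, u_r}, where for each 1 ≤ i ≤ r the vertex u_i is the endpoint adjacent to v of a stem S_i of length c_i ≥ 1 attached to v, the stems S_1, …, S_r are pairwise disjoint, and z lies in no S_i. Let d = c_1 + c_2 + ⋯ + c_r. Then t(v) = (t(x) + t(y))/2 + (d + 1). -/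
theorem SatisfiesASUA.eq_of_degree_eq_one_s5 {V : Type*} [Fintype V] {G : SimpleGraph V}
    [DecidableRel G.Adj] {z : V} {t : V → ℝ} (ht : SatisfiesASUA G z t) {a b : V} (ha : a ≠ z)
    (hdeg : G.degree a = 1) (hab : G.Adj a b) : t a = 1 + t b := by
  have hs : G.neighborFinset a = {b} := by
    refine (Finset.eq_of_subset_of_card_le (by simpa using hab) ?_).symm
    rw [G.card_neighborFinset_eq_degree, hdeg, Finset.card_singleton]
  have h := ht.2 a ha
  rw [hs, hdeg, Finset.sum_singleton] at h
  simpa using h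

theorem SatisfiesASUA.eq_of_degree_eq_two_s5 {V : Type*} [Fintype V] {G : SimpleGraph V}
    [DecidableRel G.Adj] {z : V} {t : V → ℝ} (ht : SatisfiesASUA G z t) {a b c : V} (ha : a ≠ z)
    (hdeg : G.degree a = 2) (hab : G.Adj a b) (hac : G.Adj a c) (hbc : b ≠ c) :
    t a = 1 + (t b + t c) / 2 := by
  classical
  have hs : G.neighborFinset a = {b, c} := by
    refine (Finset.eq_of_subset_of_card_le ?_ ?_).symm
    · intro w hw
      rcases Finset.mem_insert.1 hw with rfl | hw
      · simpa using hab
      · rw [Finset.mem_singleton.1 hw]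
        simpa using hac
    · rw [G.card_neighborFinset_eq_degree, hdeg, Finset.card_pair hbc]
  have h := ht.2 a ha
  rw [hs, hdeg, Finset.sum_pair hbc] at h
  rw [h]
  push_cast
  ring

/-- Along a stem, the value at the `j`-th vertex exceeds the value at the next vertex
(which is `v` after the last one) by `2 * j - 1`. -/
theorem SatisfiesASUA.stem_step {V : Type*} [Fintype V] {G : SimpleGraph V}
    [DecidableRel G.Adj] {z : V} {t : V → ℝ} (ht : SatisfiesASUA G z t) {v : V} {l : ℕ}
    {u : ℕ → V} (hu : IsStem G v l u) (hz : ∀ j, 1 ≤ j → j ≤ l → u j ≠ z) (j : ℕ) (hj : 1 ≤ j)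
    (hjl : j ≤ l) : t (u j) = 2 * j - 1 + t (if j < l then u (j + 1) else v) := by
  obtain ⟨hv, hinj, hadj, hend, hone, htwo⟩ := hu
  have hnext : ∀ k, 1 ≤ k → k ≤ l → G.Adj (u k) (if k < l then u (k + 1) else v) := by
    intro k hk hkl
    split_ifs with h
    · exact hadj k hk (by omega)
    · rwa [show k = l by omega]
  induction j, hj using Nat.le_induction with
  | base =>
    rw [ht.eq_of_degree_eq_one_s5 (hz 1 le_rfl hjl) hone (hnext 1 le_rfl hjl)]
    norm_num
  | succ k hk ih =>
    have hprev := ih (by omega)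
    rw [if_pos (by omega)] at hprev
    have hne : u k ≠ if k + 1 < l then u (k + 1 + 1) else v := by
      split_ifs with h
      · intro he
        have := hinj ⟨hk, by omega⟩ ⟨by omega, by omega⟩ he
        omega
      · exact hv k hk (by omega)
    have h := ht.eq_of_degree_eq_two_s5 (hz (k + 1) (by omega) hjl) (htwo (k + 1) (by omega) hjl)
      (hadj k hk (by omega)).symm (hnext (k + 1) (by omega) hjl) hne
    push_cast
    linarith

theorem SatisfiesASUA.stem_endpoint {V : Type*} [Fintype V] {G : SimpleGraph V}
    [DecidableRel G.Adj] {z : V} {t : V → ℝ} (ht : SatisfiesASUA G z t) {v : V} {l : ℕ}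
    (hl : 1 ≤ l) {u : ℕ → V} (hu : IsStem G v l u) (hz : ∀ j, 1 ≤ j → j ≤ l → u j ≠ z) :
    t (u l) = 2 * l - 1 + t v := by
  simpa using ht.stem_step hu hz l hl le_rfl

/-- If the neighborhood of `v ≠ z` consists of two vertices `x, y` together with the
endpoints `w i (c i)` of `r` pairwise disjoint stems attached to `v`, none containing the
absorbing vertex `z`, and `d = c 1 + ⋯ + c r`, then `t v = (t x + t y)/2 + (d + 1)`. -/
theorem asua_stems_vertex {V : Type*} [Fintype V] [DecidableEq V]
    (G : SimpleGraph V) [DecidableRel G.Adj] (z : V)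
    (t : V → ℝ) (ht : SatisfiesASUA G z t)
    (v x y : V) (hvz : v ≠ z)
    (r : ℕ) (hr : 1 ≤ r) (c : Fin r → ℕ) (hc : ∀ i, 1 ≤ c i)
    (w : Fin r → ℕ → V)
    (hstem : ∀ i, IsStem G v (c i) (w i))
    (hdisj : ∀ i i', i ≠ i' → ∀ j j', 1 ≤ j → j ≤ c i → 1 ≤ j' → j' ≤ c i' →
      w i j ≠ w i' j')
    (hz : ∀ i j, 1 ≤ j → j ≤ c i → w i j ≠ z)
    (hx : ∀ i, w i (c i) ≠ x) (hy : ∀ i, w i (c i) ≠ y) (hxy : x ≠ y)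
    (hN : G.neighborFinset v =
      insert x (insert y (Finset.image (fun i => w i (c i)) Finset.univ))) :
    t v = (t x + t y) / 2 + (((∑ i, c i : ℕ) : ℝ) + 1) := by
  have hinj : Function.Injective fun i => w i (c i) := by
    intro i i' h
    by_contra hne
    exact hdisj i i' hne _ _ (hc i) le_rfl (hc i') le_rfl h
  have hy' : y ∉ Finset.univ.image fun i => w i (c i) := by simpa using hy
  have hx' : x ∉ insert y (Finset.univ.image fun i => w i (c i)) := by simpa [hxy] using hx
  have hdeg : G.degree v = r + 2 := by
    rw [← G.card_neighborFinset_eq_degree, hN, Finset.card_insert_of_notMem hx',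
      Finset.card_insert_of_notMem hy', Finset.card_image_of_injective _ hinj, Finset.card_univ,
      Fintype.card_fin]
  have hsum : ∑ i, t (w i (c i)) = 2 * ∑ i, (c i : ℝ) - r + r * t v := by
    rw [Finset.sum_congr rfl fun i _ => ht.stem_endpoint (hc i) (hstem i) (hz i)]
    simp [Finset.sum_add_distrib, Finset.sum_sub_distrib, Finset.mul_sum]
  have h := ht.2 v hvz
  rw [hdeg, hN, Finset.sum_insert hx', Finset.sum_insert hy',
    Finset.sum_image hinj.injOn, hsum] at h
  have hr' : (r : ℝ) + 2 ≠ 0 := by positivity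
  push_cast at h ⊢
  field_simp at h
  linarith
end
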